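/- Let R > 0 and define w(s) = [(4R − 2)s³ + (−6R² − 6R + 3)s² + (12R² − 12R + 6)s + 2R⁴ − 4R³ + 6R² − 6R + 3]·e^{4(R − s)} − (4R + 2)s³ + (6R² − 6R − 3)s² + (12R² + 12R + 6)s − 2R⁴ − 4R³ − 6R² − 6R − 3. Then w(s) > 0 for every 0 < s < R. -/

import Mathlib

theorem aux_pos (f f' : ℝ → ℝ) (h : ∀ x, HasDerivAt f (f' x) x) (h0 : f 0 = 0)
    (hp : ∀ x, 0 < x → 0 < f' x) (t : ℝ) (ht : 0 < t) : 0 < f t := by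
  have hm : StrictMonoOn f (Set.Ici 0) := by
    apply strictMonoOn_of_deriv_pos (convex_Ici 0)
    · exact fun x _ => (h x).continuousAt.continuousWithinAt
    · intro x hx
      rw [interior_Ici] at hx
      rw [(h x).deriv]
      exact hp x hx
  have := hm (Set.mem_Ici.2 le_rfl) (Set.mem_Ici.2 ht.le) ht
  rwa [h0] at this

theorem dS (x : ℝ) : HasDerivAt (fun x : ℝ => Real.sinh (2 * x)) (2 * Real.cosh (2 * x)) x := by
  have := ((hasDerivAt_id x).const_mul 2).sinh
  refine HasDerivAt.congr_deriv this ?_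
  simp only [id]; ring

theorem dC (x : ℝ) : HasDerivAt (fun x : ℝ => Real.cosh (2 * x)) (2 * Real.sinh (2 * x)) x := by
  have := ((hasDerivAt_id x).const_mul 2).cosh
  refine HasDerivAt.congr_deriv this ?_
  simp only [id]; ring

theorem g_pos (t : ℝ) (ht : 0 < t) :
    0 < (2*t^4+6*t^2+3) * Real.sinh (2*t) - (6*t+4*t^3) * Real.cosh (2*t) := by
  refine aux_pos (fun t => (2*t^4+6*t^2+3) * Real.sinh (2*t) - (6*t+4*t^3) * Real.cosh (2*t))
    (fun t => 4*t^4 * Real.cosh (2*t)) ?_ (by simp) ?_ t ht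
  · intro x
    have h1 : HasDerivAt (fun t : ℝ => 2*t^4+6*t^2+3) (8*x^3+12*x) x := by
      refine HasDerivAt.congr_deriv ((((hasDerivAt_pow 4 x).const_mul 2).add ((hasDerivAt_pow 2 x).const_mul 6)).add_const 3) ?_
      norm_num <;> ring
    have h2 : HasDerivAt (fun t : ℝ => 6*t+4*t^3) (6+12*x^2) x := by
      refine HasDerivAt.congr_deriv (((hasDerivAt_id x).const_mul 6).add ((hasDerivAt_pow 3 x).const_mul 4)) ?_
      norm_num <;> ring
    refine HasDerivAt.congr_deriv ((h1.mul (dS x)).sub (h2.mul (dC x))) ?_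
    ring
  · intro x hx
    have := Real.cosh_pos (2*x)
    positivity

theorem h_pos (t : ℝ) (ht : 0 < t) :
    0 < (6*t^2-3) * Real.sinh (2*t) + 6*t * Real.cosh (2*t) := by
  refine aux_pos (fun t => (6*t^2-3) * Real.sinh (2*t) + 6*t * Real.cosh (2*t))
    (fun t => 24*t*Real.sinh (2*t) + 12*t^2 * Real.cosh (2*t)) ?_ (by simp) ?_ t ht
  · intro x
    have h1 : HasDerivAt (fun t : ℝ => 6*t^2-3) (12*x) x := by
      refine HasDerivAt.congr_deriv (((hasDerivAt_pow 2 x).const_mul 6).sub_const 3) ?_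
      norm_num <;> ring
    have h2 : HasDerivAt (fun t : ℝ => 6*t) 6 x := by
      refine HasDerivAt.congr_deriv ((hasDerivAt_id x).const_mul 6) ?_
      norm_num
    refine HasDerivAt.congr_deriv ((h1.mul (dS x)).add (h2.mul (dC x))) ?_
    ring
  · intro x hx
    have := Real.cosh_pos (2*x)
    have : 0 < Real.sinh (2*x) := Real.sinh_pos_iff.2 (by linarith)
    positivity

/-- The auxiliary function w is positive on (0,R). -/
theorem stmt_18 (R : ℝ) (hR : 0 < R) (s : ℝ) (hs0 : 0 < s) (hsR : s < R) :
    ((4 * R - 2) * s ^ 3 + (-6 * R ^ 2 - 6 * R + 3) * s ^ 2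
        + (12 * R ^ 2 - 12 * R + 6) * s + 2 * R ^ 4 - 4 * R ^ 3 + 6 * R ^ 2 - 6 * R + 3)
      * Real.exp (4 * (R - s))
    - (4 * R + 2) * s ^ 3 + (6 * R ^ 2 - 6 * R - 3) * s ^ 2
    + (12 * R ^ 2 + 12 * R + 6) * s - 2 * R ^ 4 - 4 * R ^ 3 - 6 * R ^ 2 - 6 * R - 3
      > 0 := by
  obtain ⟨t, rfl⟩ : ∃ t, R = s + t := ⟨R - s, by ring⟩
  have ht : 0 < t := by linarith
  have hg := g_pos t ht
  have hh := h_pos t ht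
  have hS : 0 < Real.sinh (2*t) := Real.sinh_pos_iff.2 (by linarith)
  have hC := Real.cosh_pos (2*t)
  have hsq := Real.cosh_sq (2*t)
  have hE : Real.exp (4 * (s + t - s)) = (Real.cosh (2*t) + Real.sinh (2*t))^2 := by
    rw [Real.cosh_add_sinh, ← Real.exp_nat_mul]
    congr 1
    push_cast
    ring
  rw [hE]
  generalize Real.sinh (2*t) = S at *
  generalize Real.cosh (2*t) = C at *
  have key : 0 < 2 * (C + S) * (((2*t^4+6*t^2+3) * S - (6*t+4*t^3) * C)
      + s^2 * ((6*t^2-3) * S + 6*t * C) + 8*s*t^3*S) := by positivity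
  refine lt_of_lt_of_eq key ?_
  linear_combination (-((4*(s+t)+2)*s^3 - (6*(s+t)^2-6*(s+t)-3)*s^2 - (12*(s+t)^2+12*(s+t)+6)*s
    + 2*(s+t)^4+4*(s+t)^3+6*(s+t)^2+6*(s+t)+3)) * hsq
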